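/- Let c be a nonzero cubic form in n variables with real coefficients, let b ∈ {1,…,n−1}, and let x⁰ ∈ ℝ^n be such that the vector Δ^{(c,b)}(x⁰) of b×b minors of H_c(x⁰) is nonzero. Then there exist a linear subspace Y ⊆ ℝ^n of dimension n−b and a constant A depending only on n such that for all Y, Y′ ∈ Y and all t ∈ ℝ^n, |Yᵀ·H_c(t)·Y′| ≤ A·( ‖J^{(c,b+1)}(x⁰)·t‖_∞ / ‖Δ^{(c,b)}(x⁰)‖_∞ + |λ_{b+1}^{(c)}(x⁰)|·‖t‖_∞ / |λ_b^{(c)}(x⁰)| )·‖Y‖_∞·‖Y′‖_∞. -/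

import Mathlib

open MvPolynomial Matrix

/-- `‖c‖ = (1/6)·max_{i,j,k} |∂³c/∂x_i∂x_j∂x_k|` for a cubic form `c`. -/
noncomputable def cubicNorm {n : ℕ} (c : MvPolynomial (Fin n) ℝ) : ℝ :=
  (1 / 6) * ⨆ i : Fin n, ⨆ j : Fin n, ⨆ k : Fin n,
    |MvPolynomial.eval (0 : Fin n → ℝ) (pderiv i (pderiv j (pderiv k c)))|

/-- The normalised Hessian matrix of `c`, as a matrix of polynomials. -/
noncomputable def hessPoly {n : ℕ} (c : MvPolynomial (Fin n) ℝ) :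
    Matrix (Fin n) (Fin n) (MvPolynomial (Fin n) ℝ) :=
  Matrix.of fun i j => MvPolynomial.C (cubicNorm c)⁻¹ * pderiv i (pderiv j c)

/-- The normalised Hessian matrix `H_c(x)`. -/
noncomputable def hessMat {n : ℕ} (c : MvPolynomial (Fin n) ℝ) (x : Fin n → ℝ) :
    Matrix (Fin n) (Fin n) ℝ :=
  Matrix.of fun i j => MvPolynomial.eval x (hessPoly c i j)

/-- Index type for the `k × k` minors of an `n × n` matrix. -/
abbrev MIdx (n k : ℕ) :=
  {p : (Fin k → Fin n) × (Fin k → Fin n) // StrictMono p.1 ∧ StrictMono p.2}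

/-- The `k × k` minors of the Hessian of `c`, as polynomials in `x`. -/
noncomputable def minorPoly {n : ℕ} (c : MvPolynomial (Fin n) ℝ) (k : ℕ)
    (p : MIdx n k) : MvPolynomial (Fin n) ℝ :=
  ((hessPoly c).submatrix p.1.1 p.1.2).det

/-- The vector `Δ^{(c,k)}(x)` of `k × k` minors of `H_c(x)`. -/
noncomputable def minorsVec {n : ℕ} (c : MvPolynomial (Fin n) ℝ) (k : ℕ)
    (x : Fin n → ℝ) (p : MIdx n k) : ℝ :=
  MvPolynomial.eval x (minorPoly c k p)

/-- The product `J^{(c,k)}(x)·t` of the Jacobian matrix of `Δ^{(c,k)}` at `x`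
with a vector `t`. -/
noncomputable def jacMulVec {n : ℕ} (c : MvPolynomial (Fin n) ℝ) (k : ℕ)
    (x t : Fin n → ℝ) (p : MIdx n k) : ℝ :=
  ∑ j : Fin n, MvPolynomial.eval x (pderiv j (minorPoly c k p)) * t j

/-- The supremum norm of a vector indexed by minors. -/
noncomputable def supMIdx {n k : ℕ} (v : MIdx n k → ℝ) : ℝ := ⨆ p, |v p|

theorem aux_pderiv_comm {n : ℕ} (i j : Fin n) (p : MvPolynomial (Fin n) ℝ) :
    pderiv i (pderiv j p) = pderiv j (pderiv i p) := by
  have h : ⁅(pderiv i : Derivation ℝ (MvPolynomial (Fin n) ℝ) (MvPolynomial (Fin n) ℝ)),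
      (pderiv j : Derivation ℝ (MvPolynomial (Fin n) ℝ) (MvPolynomial (Fin n) ℝ))⁆ = 0 := by
    apply MvPolynomial.derivation_ext
    intro k
    rw [Derivation.commutator_apply]
    simp only [pderiv_X, Derivation.coe_zero, Pi.zero_apply]
    simp only [Pi.single_apply]
    split_ifs <;> simp
  have h2 := congrArg (fun D => D p) h
  simp only [Derivation.commutator_apply, Derivation.coe_zero, Pi.zero_apply] at h2
  exact sub_eq_zero.mp h2

/-- the directional derivative functional -/
noncomputable def auxL {n : ℕ} (x t : Fin n → ℝ) : MvPolynomial (Fin n) ℝ →ₗ[ℝ] ℝ where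
  toFun p := ∑ j : Fin n, MvPolynomial.eval x (pderiv j p) * t j
  map_add' p q := by simp [add_mul, Finset.sum_add_distrib]
  map_smul' r p := by simp [Finset.mul_sum, mul_assoc, MvPolynomial.smul_eval]

theorem auxL_apply {n : ℕ} (x t : Fin n → ℝ) (p : MvPolynomial (Fin n) ℝ) :
    auxL x t p = ∑ j : Fin n, MvPolynomial.eval x (pderiv j p) * t j := rfl

theorem auxL_mul {n : ℕ} (x t : Fin n → ℝ) (p q : MvPolynomial (Fin n) ℝ) :
    auxL x t (p * q) = auxL x t p * eval x q + eval x p * auxL x t q := by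
  simp only [auxL_apply, pderiv_mul, map_add, map_mul, Finset.sum_mul, Finset.mul_sum,
    ← Finset.sum_add_distrib]
  refine Finset.sum_congr rfl fun j _ => ?_
  ring

theorem auxL_prod {n : ℕ} (x t : Fin n → ℝ) {ι : Type*} [DecidableEq ι] (s : Finset ι)
    (Q : ι → MvPolynomial (Fin n) ℝ) :
    auxL x t (∏ i ∈ s, Q i) = ∑ k ∈ s, auxL x t (Q k) * ∏ l ∈ s.erase k, eval x (Q l) := by
  induction s using Finset.induction_on with
  | empty => simp [auxL_apply]
  | insert a s ha ih =>
    rw [Finset.prod_insert ha, auxL_mul, ih, Finset.sum_insert ha, Finset.erase_insert ha,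
      map_prod, Finset.mul_sum]
    congr 1
    refine Finset.sum_congr rfl fun k hk => ?_
    have hak : a ≠ k := fun h => ha (h ▸ hk)
    rw [Finset.erase_insert_of_ne hak, Finset.prod_insert (by simp [ha])]
    ring

theorem auxL_det_diag {n m : ℕ} (x t : Fin n → ℝ)
    (Q : Matrix (Fin m) (Fin m) (MvPolynomial (Fin n) ℝ))
    (hQ : ∀ i j, i ≠ j → eval x (Q i j) = 0) :
    auxL x t Q.det = ∑ k, auxL x t (Q k k) * ∏ l ∈ Finset.univ.erase k, eval x (Q l l) := by
  rw [Matrix.det_apply, map_sum, Finset.sum_eq_single 1]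
  · simp [auxL_prod]
  · intro σ _ hσ
    have : auxL x t (∏ i, Q (σ i) i) = 0 := by
      rw [auxL_prod]
      refine Finset.sum_eq_zero fun k _ => ?_
      have : ∃ l, l ≠ k ∧ σ l ≠ l := by
        by_contra hcon
        push Not at hcon
        apply hσ
        ext l
        by_cases hl : l = k
        · subst hl
          by_contra hne
          have h1 : σ l ≠ l := fun h => hne (by simp [h])
          have := hcon _ h1
          exact h1 (σ.injective this)
        · simp [hcon l hl]
      obtain ⟨l, hl, hl2⟩ := this
      rw [Finset.prod_eq_zero (i := l) (by simp [hl]) (hQ _ _ hl2), mul_zero]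
    rcases Int.units_eq_one_or (Equiv.Perm.sign σ) with h | h <;> simp [h, this]
  · simp

theorem aux_CB1 {R : Type*} [CommRing R] {m n : ℕ} (A : Matrix (Fin m) (Fin n) R)
    (B : Matrix (Fin n) (Fin m) R) :
    (A * B).det = ∑ h : Fin m → Fin n, (∏ i, A i (h i)) * (B.submatrix h id).det := by
  have h1 : (A * B) = fun i => ∑ j, A i j • B j := by
    ext i j
    simp [Matrix.mul_apply, Finset.sum_apply]
  have h2 := (Matrix.detRowAlternating (R := R) (n := Fin m)).toMultilinearMap.map_sum
    (fun (i : Fin m) (j : Fin n) => A i j • B j)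
  rw [h1]
  refine h2.trans ?_
  refine Finset.sum_congr rfl fun h _ => ?_
  rw [MultilinearMap.map_smul_univ]
  rfl

theorem aux_CB2 {R : Type*} [CommRing R] {m n : ℕ} (A : Matrix (Fin m) (Fin n) R)
    (B : Matrix (Fin n) (Fin n) R) (C : Matrix (Fin n) (Fin m) R) :
    (A * B * C).det = ∑ h : Fin m → Fin n, ∑ h' : Fin m → Fin n,
      (∏ i, A i (h i)) * (∏ i, C (h' i) i) * (B.submatrix h h').det := by
  rw [Matrix.mul_assoc, aux_CB1]
  refine Finset.sum_congr rfl fun h _ => ?_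
  have : ((B * C).submatrix h id) = (Cᵀ * (B.submatrix h id)ᵀ)ᵀ := by
    ext i j; simp [Matrix.mul_apply, mul_comm]
  rw [this, Matrix.det_transpose, aux_CB1, Finset.mul_sum]
  refine Finset.sum_congr rfl fun h' _ => ?_
  rw [← Matrix.det_transpose (((B.submatrix h id)ᵀ).submatrix h' id), mul_assoc]
  rfl

theorem aux_minor {R : Type*} [CommRing R] {k n : ℕ} (K : Matrix (Fin n) (Fin n) R)
    (f g : Fin k → Fin n) :
    (K.submatrix f g).det = 0 ∨ ∃ p : MIdx n k,
      (K.submatrix f g).det = (K.submatrix p.1.1 p.1.2).det ∨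
      (K.submatrix f g).det = -(K.submatrix p.1.1 p.1.2).det := by
  by_cases hf : Function.Injective f
  swap
  · left
    simp only [Function.Injective, not_forall] at hf
    obtain ⟨a, b, h1, h2⟩ := hf
    exact Matrix.det_zero_of_row_eq h2 (by ext j; simp [h1])
  by_cases hg : Function.Injective g
  swap
  · left
    simp only [Function.Injective, not_forall] at hg
    obtain ⟨a, b, h1, h2⟩ := hg
    exact Matrix.det_zero_of_column_eq h2 (by intro j; simp [h1])
  right
  refine ⟨⟨(f ∘ Tuple.sort f, g ∘ Tuple.sort g),
    (Tuple.monotone_sort f).strictMono_of_injective (hf.comp (Equiv.injective _)),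
    (Tuple.monotone_sort g).strictMono_of_injective (hg.comp (Equiv.injective _))⟩, ?_⟩
  have h : (K.submatrix (f ∘ Tuple.sort f) (g ∘ Tuple.sort g)) =
    ((K.submatrix f g).submatrix id (Tuple.sort g)).submatrix (Tuple.sort f) id := rfl
  simp only [h, Matrix.det_permute, Matrix.det_permute']
  rcases Int.units_eq_one_or (Equiv.Perm.sign (Tuple.sort f)) with h | h <;>
  rcases Int.units_eq_one_or (Equiv.Perm.sign (Tuple.sort g)) with h' | h' <;> simp [h, h']

theorem aux_le_sup {n k : ℕ} (v : MIdx n k → ℝ) (p : MIdx n k) : |v p| ≤ supMIdx v :=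
  le_ciSup (f := fun p => |v p|) (Set.finite_range _).bddAbove p

theorem aux_sup_nonneg {n k : ℕ} (v : MIdx n k → ℝ) : 0 ≤ supMIdx v :=
  Real.iSup_nonneg fun _ => abs_nonneg _

theorem aux_spec {n : ℕ} (M : Matrix (Fin n) (Fin n) ℝ) (hM : Mᵀ = M) (lam : Fin n → ℝ)
    (h : M.charpoly = ∏ i, (Polynomial.X - Polynomial.C (lam i))) :
    ∃ O : Matrix (Fin n) (Fin n) ℝ, Oᵀ * O = 1 ∧ O * Oᵀ = 1 ∧
      Oᵀ * M * O = Matrix.diagonal lam := by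
  have hH : M.IsHermitian := by
    rw [Matrix.IsHermitian, Matrix.conjTranspose_eq_transpose_of_trivial, hM]
  have h1 := hH.roots_charpoly_eq_eigenvalues
  rw [h, Polynomial.roots_prod _ _
    (by simp [Finset.prod_ne_zero_iff, Polynomial.X_sub_C_ne_zero])] at h1
  have h2 : Multiset.map lam Finset.univ.val = Multiset.map hH.eigenvalues Finset.univ.val := by
    simpa using h1
  have h3 : ∀ a : ℝ, Nonempty ({i // lam i = a} ≃ {i // hH.eigenvalues i = a}) := by
    intro a
    have := congrArg (Multiset.count a) h2
    rw [Multiset.count_map, Multiset.count_map] at this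
    refine ⟨Fintype.equivOfCardEq ?_⟩
    rw [Fintype.card_subtype, Fintype.card_subtype, Finset.card_def, Finset.card_def,
      Finset.filter_val, Finset.filter_val]
    simpa [eq_comm] using this
  let e := Equiv.ofFiberEquiv (fun a => (h3 a).some)
  have he : ∀ i, hH.eigenvalues (e i) = lam i := fun i => Equiv.ofFiberEquiv_map _ i
  let U : Matrix (Fin n) (Fin n) ℝ := hH.eigenvectorUnitary
  have hU1 : Uᵀ * U = 1 := by
    have := Unitary.coe_star_mul_self hH.eigenvectorUnitary
    simpa [Matrix.star_eq_conjTranspose] using this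
  have hU2 : Uᵀ * M * U = Matrix.diagonal hH.eigenvalues := by
    have := hH.conjStarAlgAut_star_eigenvectorUnitary
    rw [Unitary.conjStarAlgAut_star_apply] at this
    simpa [Matrix.star_eq_conjTranspose, Function.comp_def] using this
  have key : (U.submatrix id e)ᵀ * (U.submatrix id e) = 1 := by
    have : (U.submatrix id e)ᵀ * (U.submatrix id e) = (Uᵀ * U).submatrix e e := rfl
    rw [this, hU1, Matrix.submatrix_one_equiv]
  refine ⟨U.submatrix id e, key, mul_eq_one_comm.mp key, ?_⟩
  have : (U.submatrix id e)ᵀ * M * (U.submatrix id e) = (Uᵀ * M * U).submatrix e e := rfl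
  rw [this, hU2]
  ext i j
  simp [Matrix.diagonal_apply, he]

theorem aux_orth_le {n : ℕ} (O : Matrix (Fin n) (Fin n) ℝ) (h : Oᵀ * O = 1) (i j : Fin n) :
    |O i j| ≤ 1 := by
  have := congrFun (congrFun h j) j
  simp only [Matrix.mul_apply, Matrix.transpose_apply, Matrix.one_apply_eq] at this
  have h2 : O i j * O i j ≤ 1 := by
    rw [← this]
    exact Finset.single_le_sum (f := fun k => O k j * O k j)
      (fun k _ => mul_self_nonneg _) (Finset.mem_univ i)
  exact abs_le_one_iff_mul_self_le_one.mpr h2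

theorem aux_hess_symm {n : ℕ} (c : MvPolynomial (Fin n) ℝ) (x : Fin n → ℝ) :
    (hessMat c x)ᵀ = hessMat c x := by
  ext i j
  simp [hessMat, hessPoly, aux_pderiv_comm i j]

theorem aux_hess_hom {n : ℕ} (c : MvPolynomial (Fin n) ℝ) (hc : c.IsHomogeneous 3) (i j k : Fin n)
    (x : Fin n → ℝ) : eval x (pderiv k (pderiv i (pderiv j c))) =
      eval 0 (pderiv k (pderiv i (pderiv j c))) := by
  have h : (pderiv k (pderiv i (pderiv j c))).IsHomogeneous 0 := hc.pderiv.pderiv.pderiv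
  rw [← totalDegree_zero_iff_isHomogeneous, totalDegree_eq_zero_iff_eq_C] at h
  rw [h]; simp

theorem auxL_hess {n : ℕ} (c : MvPolynomial (Fin n) ℝ) (hc : c.IsHomogeneous 3)
    (x t : Fin n → ℝ) (i j : Fin n) : auxL x t (hessPoly c i j) = hessMat c t i j := by
  have h1 : (pderiv i (pderiv j c)).IsHomogeneous 1 := hc.pderiv.pderiv
  have h2 := congrArg (eval t) h1.sum_X_mul_pderiv
  simp only [map_sum, map_mul, eval_X, one_smul] at h2
  simp only [hessMat, hessPoly, Matrix.of_apply, map_mul, eval_C, auxL_apply, pderiv_C_mul, ← h2]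
  rw [Finset.mul_sum]
  refine Finset.sum_congr rfl fun k _ => ?_
  rw [aux_hess_hom c hc i j k x, aux_hess_hom c hc i j k t]
  ring

theorem aux_hess_bound {n : ℕ} (c : MvPolynomial (Fin n) ℝ) (hc : c.IsHomogeneous 3)
    (t : Fin n → ℝ) (i j : Fin n) : |hessMat c t i j| ≤ 6 * n * ‖t‖ := by
  have hD : ∀ k, |eval 0 (pderiv k (pderiv i (pderiv j c)))| ≤ 6 * cubicNorm c := by
    intro k
    have e1 : |eval (0 : Fin n → ℝ) (pderiv k (pderiv i (pderiv j c)))| ≤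
       ⨆ k : Fin n, ⨆ i : Fin n, ⨆ j : Fin n,
        |MvPolynomial.eval (0 : Fin n → ℝ) (pderiv k (pderiv i (pderiv j c)))| := by
      refine le_trans ?_ (le_ciSup (Set.finite_range _).bddAbove k)
      refine le_trans ?_ (le_ciSup (Set.finite_range _).bddAbove i)
      exact le_ciSup (f := fun j =>
        |MvPolynomial.eval (0 : Fin n → ℝ) (pderiv k (pderiv i (pderiv j c)))|)
        (Set.finite_range _).bddAbove j
    unfold cubicNorm
    linarith
  have hN : 0 ≤ cubicNorm c := by
    have := (abs_nonneg _).trans (hD i); linarith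
  rw [← auxL_hess c hc 0 t, auxL_apply]
  refine (Finset.abs_sum_le_sum_abs _ _).trans ?_
  have : ∀ k ∈ (Finset.univ : Finset (Fin n)),
      |eval 0 (pderiv k (hessPoly c i j)) * t k| ≤ 6 * ‖t‖ := by
    intro k _
    simp only [hessPoly, Matrix.of_apply, pderiv_C_mul, abs_mul, map_mul, eval_C]
    have h1 : |t k| ≤ ‖t‖ := norm_le_pi_norm t k
    have h2 : |(cubicNorm c)⁻¹| * |eval 0 (pderiv k (pderiv i (pderiv j c)))| ≤ 6 := by
      rw [abs_inv, abs_of_nonneg hN]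
      rcases hN.eq_or_lt with h | h
      · rw [← h]; simp
      · rw [inv_mul_le_iff₀ h]; linarith [hD k]
    exact mul_le_mul h2 h1 (abs_nonneg _) (by norm_num)
  refine (Finset.sum_le_card_nsmul _ _ _ this).trans ?_
  simp
  linarith

theorem aux_minor_bound {n k : ℕ} (c : MvPolynomial (Fin n) ℝ) (x t : Fin n → ℝ)
    (f g : Fin k → Fin n) :
    |auxL x t ((hessPoly c).submatrix f g).det| ≤ supMIdx (jacMulVec c k x t) := by
  rcases aux_minor (hessPoly c) f g with h | ⟨p, h | h⟩
  · rw [h]; simpa using aux_sup_nonneg _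
  · rw [h]; exact aux_le_sup (jacMulVec c k x t) p
  · rw [h, map_neg, abs_neg]; exact aux_le_sup (jacMulVec c k x t) p

theorem aux_prod_le {n b : ℕ} (lam : Fin n → ℝ) (hb : b ≤ n)
    (hl : ∀ i j : Fin n, i ≤ j → |lam j| ≤ |lam i|) (h : Fin b → Fin n)
    (hinj : Function.Injective h) :
    ∏ i, |lam (h i)| ≤ ∏ i : Fin b, |lam (Fin.castLE hb i)| := by
  rw [← Equiv.prod_comp (Tuple.sort h)]
  have hs : StrictMono (h ∘ Tuple.sort h) :=
    (Tuple.monotone_sort h).strictMono_of_injective (hinj.comp (Equiv.injective _))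
  have hle : ∀ (m : ℕ) (hm : m < b), m ≤ ((h ∘ Tuple.sort h) ⟨m, hm⟩ : ℕ) := by
    intro m
    induction m with
    | zero => intro _; exact Nat.zero_le _
    | succ m ih =>
      intro hm
      have h1 := ih (by omega)
      have h2 : (h ∘ Tuple.sort h) ⟨m, by omega⟩ < (h ∘ Tuple.sort h) ⟨m + 1, hm⟩ :=
        hs (by simp [Fin.lt_def])
      have h3 := Fin.lt_def.mp h2
      omega
  refine Finset.prod_le_prod (fun i _ => abs_nonneg _) fun i _ => ?_
  exact hl _ _ (Fin.le_def.mpr (hle i.1 i.2))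

theorem aux_abs_det_le {b n : ℕ} (hb : b ≤ n) (B : Matrix (Fin b) (Fin b) ℝ)
    (hB : ∀ i j, |B i j| ≤ 1) :
    |B.det| ≤ (n.factorial : ℝ) := by
  rw [Matrix.det_apply]
  refine (Finset.abs_sum_le_sum_abs _ _).trans ?_
  have : ∀ σ ∈ (Finset.univ : Finset (Equiv.Perm (Fin b))),
      |Equiv.Perm.sign σ • ∏ i, B (σ i) i| ≤ 1 := by
    intro σ _
    have h : |∏ i, B (σ i) i| ≤ 1 := by
      rw [Finset.abs_prod]
      exact Finset.prod_le_one (fun _ _ => abs_nonneg _) fun _ _ => hB _ _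
    rcases Int.units_eq_one_or (Equiv.Perm.sign σ) with h' | h' <;> simpa [h'] using h
  refine (Finset.sum_le_card_nsmul _ _ _ this).trans ?_
  simp [Fintype.card_perm]
  exact_mod_cast Nat.factorial_le hb

theorem aux_prod_abs_le {b n : ℕ} (O : Matrix (Fin n) (Fin n) ℝ) (hO : ∀ i j, |O i j| ≤ 1)
    (f g : Fin b → Fin n) : |∏ i, O (f i) (g i)| ≤ 1 := by
  rw [Finset.abs_prod]
  exact Finset.prod_le_one (fun _ _ => abs_nonneg _) fun _ _ => hO _ _

theorem aux_Delta_bound {n b : ℕ} (hn : 1 ≤ n) (hb : b ≤ n) (M O : Matrix (Fin n) (Fin n) ℝ)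
    (lam : Fin n → ℝ) (hl : ∀ i j : Fin n, i ≤ j → |lam j| ≤ |lam i|)
    (hO : ∀ i j, |O i j| ≤ 1) (hM : M = O * Matrix.diagonal lam * Oᵀ) (f g : Fin b → Fin n) :
    |(M.submatrix f g).det| ≤ (n ^ n * n.factorial : ℝ) * ∏ i : Fin b, |lam (Fin.castLE hb i)| := by
  have h1 : M.submatrix f g = O.submatrix f id * (Matrix.diagonal lam * Oᵀ.submatrix id g) := by
    rw [hM, Matrix.mul_assoc]; rfl
  have hP : 0 ≤ ∏ i : Fin b, |lam (Fin.castLE hb i)| := Finset.prod_nonneg fun _ _ => abs_nonneg _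
  rw [h1, aux_CB1]
  refine (Finset.abs_sum_le_sum_abs _ _).trans ?_
  have : ∀ h ∈ (Finset.univ : Finset (Fin b → Fin n)),
     |(∏ i, O.submatrix f id i (h i)) *
      ((Matrix.diagonal lam * Oᵀ.submatrix id g).submatrix h id).det| ≤
      n.factorial * ∏ i : Fin b, |lam (Fin.castLE hb i)| := by
    intro h _
    have e : (Matrix.diagonal lam * Oᵀ.submatrix id g).submatrix h id =
        Matrix.of fun i j => lam (h i) * (Oᵀ.submatrix h g) i j := by
      ext i j; simp
    rw [abs_mul]
    refine (mul_le_of_le_one_left (abs_nonneg _) (aux_prod_abs_le O hO f h)).trans ?_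
    rw [e, Matrix.det_mul_column, abs_mul, Finset.abs_prod, mul_comm]
    by_cases hinj : Function.Injective h
    · exact mul_le_mul (aux_abs_det_le hb _ fun i j => hO _ _) (aux_prod_le lam hb hl h hinj)
        (Finset.prod_nonneg fun _ _ => abs_nonneg _) (by positivity)
    · simp only [Function.Injective, not_forall] at hinj
      obtain ⟨a, b, h1, h2⟩ := hinj
      rw [Matrix.det_zero_of_row_eq h2 (by ext j; simp [h1])]
      simp only [abs_zero, zero_mul]
      positivity
  refine (Finset.sum_le_card_nsmul _ _ _ this).trans ?_
  simp only [Finset.card_univ, Fintype.card_fun, Fintype.card_fin, nsmul_eq_mul, Nat.cast_pow]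
  rw [mul_assoc]
  have : (n : ℝ) ^ b ≤ n ^ n := pow_le_pow_right₀ (by exact_mod_cast hn) hb
  gcongr

theorem aux_jac_bound {n k : ℕ} (hn : 1 ≤ n) (hk : k ≤ n) (c : MvPolynomial (Fin n) ℝ)
    (x t : Fin n → ℝ)
    (O : Matrix (Fin n) (Fin n) ℝ)
    (CO : Matrix (Fin n) (Fin n) (MvPolynomial (Fin n) ℝ)) (hCO : ∀ i j, CO i j = C (O i j))
    (hO : ∀ i j, |O i j| ≤ 1) (f g : Fin k → Fin n) :
    |auxL x t ((COᵀ * hessPoly c * CO).submatrix f g).det| ≤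
      (n ^ n * n ^ n : ℝ) * supMIdx (jacMulVec c k x t) := by
  have h1 : (COᵀ * hessPoly c * CO).submatrix f g =
    COᵀ.submatrix f id * hessPoly c * CO.submatrix id g := rfl
  rw [h1, aux_CB2, map_sum]
  have hS := aux_sup_nonneg (jacMulVec c k x t)
  have hpow : (n : ℝ) ^ k ≤ n ^ n := pow_le_pow_right₀ (by exact_mod_cast hn) hk
  have e : ∀ h ∈ (Finset.univ : Finset (Fin k → Fin n)), ∀ h' ∈ (Finset.univ : Finset (Fin k → Fin n)),
     |auxL x t ((∏ i, COᵀ.submatrix f id i (h i)) *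
      (∏ i, CO.submatrix id g (h' i) i) * ((hessPoly c).submatrix h h').det)| ≤
       supMIdx (jacMulVec c k x t) := by
    intro h _ h' _
    have e1 : (∏ i, COᵀ.submatrix f id i (h i)) *
      (∏ i, CO.submatrix id g (h' i) i) * ((hessPoly c).submatrix h h').det =
      ((∏ i, O (h i) (f i)) * ∏ i, O (h' i) (g i)) • ((hessPoly c).submatrix h h').det := by
      simp [smul_eq_C_mul, hCO]
    rw [e1, map_smul, smul_eq_mul, abs_mul, abs_mul]
    refine (mul_le_of_le_one_left (abs_nonneg _) ?_).trans (aux_minor_bound c x t h h')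
    exact mul_le_one₀ (aux_prod_abs_le O hO h f) (abs_nonneg _) (aux_prod_abs_le O hO h' g)
  refine (Finset.abs_sum_le_sum_abs _ _).trans ?_
  have e2 : ∀ h ∈ (Finset.univ : Finset (Fin k → Fin n)), |auxL x t (∑ h' : Fin k → Fin n, (∏ i, COᵀ.submatrix f id i (h i)) *
      (∏ i, CO.submatrix id g (h' i) i) * ((hessPoly c).submatrix h h').det)| ≤
      n ^ n * supMIdx (jacMulVec c k x t) := by
    intro h hh
    rw [map_sum]
    refine (Finset.abs_sum_le_sum_abs _ _).trans ?_
    refine (Finset.sum_le_card_nsmul _ _ _ (e h hh)).trans ?_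
    simp only [Finset.card_univ, Fintype.card_fun, Fintype.card_fin, nsmul_eq_mul, Nat.cast_pow]
    gcongr
  refine (Finset.sum_le_card_nsmul _ _ _ e2).trans ?_
  simp only [Finset.card_univ, Fintype.card_fun, Fintype.card_fin, nsmul_eq_mul, Nat.cast_pow]
  rw [mul_assoc]
  gcongr

theorem aux_key {n b : ℕ} (hb : b < n) (hb1 : 1 ≤ b) (x t : Fin n → ℝ)
    (Q : Matrix (Fin n) (Fin n) (MvPolynomial (Fin n) ℝ)) (lam : Fin n → ℝ)
    (hQ : ∀ i j, eval x (Q i j) = Matrix.diagonal lam i j)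
    (hl : ∀ i j : Fin n, i ≤ j → |lam j| ≤ |lam i|)
    (hP : 0 < ∏ i : Fin b, |lam (Fin.castLE hb.le i)|)
    (E T : ℝ) (hT : ∀ i, |auxL x t (Q i i)| ≤ T)
    (hE : ∀ f g : Fin (b + 1) → Fin n, |auxL x t (Q.submatrix f g).det| ≤ E)
    (i j : Fin n) (hi : b ≤ i.1) (hj : b ≤ j.1) :
    |auxL x t (Q i j)| ≤ E / ∏ i : Fin b, |lam (Fin.castLE hb.le i)|
      + n * (T * (|lam ⟨b, hb⟩| / |lam ⟨b - 1, by omega⟩|)) := by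
  set P := ∏ i : Fin b, |lam (Fin.castLE hb.le i)| with hPdef
  have hlam : ∀ k : Fin b, 0 < |lam (Fin.castLE hb.le k)| := by
    intro k
    have := Finset.prod_ne_zero_iff.mp hP.ne' k (Finset.mem_univ _)
    exact lt_of_le_of_ne (abs_nonneg _) (Ne.symm this)
  have hT0 : 0 ≤ T := (abs_nonneg _).trans (hT i)
  let f : Fin (b + 1) → Fin n := Fin.snoc (α := fun _ => Fin n) (Fin.castLE hb.le) i
  let g : Fin (b + 1) → Fin n := Fin.snoc (α := fun _ => Fin n) (Fin.castLE hb.le) j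
  have hfc : ∀ k : Fin b, f k.castSucc = Fin.castLE hb.le k := fun k => by simp [f]
  have hgc : ∀ k : Fin b, g k.castSucc = Fin.castLE hb.le k := fun k => by simp [g]
  have hfl : f (Fin.last b) = i := by simp [f]
  have hgl : g (Fin.last b) = j := by simp [g]
  have hne : ∀ k l, k ≠ l → f k ≠ g l := by
    intro k l
    induction k using Fin.lastCases with
    | last =>
      induction l using Fin.lastCases with
      | last => simp
      | cast l =>
        intro _ h
        rw [hfl, hgc] at h
        have := congrArg Fin.val h
        simp at this; omega
    | cast k =>
      induction l using Fin.lastCases with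
      | last =>
        intro _ h
        rw [hgl, hfc] at h
        have := congrArg Fin.val h
        simp at this; omega
      | cast l =>
        intro hkl h
        rw [hfc, hgc] at h
        have := congrArg Fin.val h
        simp at this
        exact hkl (by rw [Fin.ext this])
  have hdet := auxL_det_diag x t (Q.submatrix f g) (by
    intro k l hkl
    simp only [Matrix.submatrix_apply, hQ]
    exact Matrix.diagonal_apply_ne _ (hne k l hkl))
  simp only [Matrix.submatrix_apply] at hdet
  set d : Fin (b + 1) → ℝ := fun l => eval x (Q (f l) (g l)) with hd
  have hdc : ∀ k : Fin b, d k.castSucc = lam (Fin.castLE hb.le k) := by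
    intro k; simp [hd, hfc, hgc, hQ]
  have hdl : |d (Fin.last b)| ≤ |lam ⟨b, hb⟩| := by
    simp only [hd, hfl, hgl, hQ, Matrix.diagonal_apply]
    split_ifs
    · exact hl _ _ (Fin.le_def.mpr hi)
    · simp
  have hprod : |∏ l, d l| = P * |d (Fin.last b)| := by
    rw [Fin.prod_univ_castSucc, abs_mul, Finset.abs_prod]
    simp only [hdc, hPdef]
  have hlast : |∏ l ∈ Finset.univ.erase (Fin.last b), d l| = P := by
    have : Finset.univ.erase (Fin.last b) = Finset.univ.map Fin.castSuccEmb := by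
      ext k
      simp only [Finset.mem_erase, Finset.mem_univ, and_true, Finset.mem_map, true_and]
      induction k using Fin.lastCases with
      | last => simp [Fin.castSucc_ne_last]
      | cast k => simp [Fin.castSucc_ne_last]
    rw [this, Finset.prod_map, Finset.abs_prod, hPdef]
    simp [hdc]
  have hoth : ∀ k : Fin b, |∏ l ∈ Finset.univ.erase k.castSucc, d l| ≤
      P * (|lam ⟨b, hb⟩| / |lam ⟨b - 1, by omega⟩|) := by
    intro k
    have h1 := Finset.mul_prod_erase Finset.univ d (Finset.mem_univ k.castSucc)
    have h2 := congrArg abs h1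
    rw [abs_mul, hprod, hdc] at h2
    have h3 : |lam ⟨b - 1, by omega⟩| ≤ |lam (Fin.castLE hb.le k)| :=
      hl _ _ (Fin.le_def.mpr (by simp; omega))
    have h4 : 0 < |lam ⟨b - 1, by omega⟩| := hlam ⟨b - 1, by omega⟩
    rw [← mul_div_assoc, le_div_iff₀ h4]
    calc _ ≤ |∏ l ∈ Finset.univ.erase k.castSucc, d l| * |lam (Fin.castLE hb.le k)| := by gcongr
      _ = P * |d (Fin.last b)| := by rw [mul_comm, h2]
      _ ≤ _ := by gcongr
  rw [Fin.sum_univ_castSucc, hfl, hgl] at hdet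
  have hEE := hE f g
  set S := ∑ k : Fin b, auxL x t (Q (f k.castSucc) (g k.castSucc)) *
    ∏ l ∈ Finset.univ.erase k.castSucc, d l with hS
  set r := |lam ⟨b, hb⟩| / |lam ⟨b - 1, by omega⟩| with hr
  have hr0 : 0 ≤ r := by positivity
  have hSb : |S| ≤ n * (T * (P * r)) := by
    refine (Finset.abs_sum_le_sum_abs _ _).trans ?_
    have : ∀ k ∈ (Finset.univ : Finset (Fin b)), |auxL x t (Q (f k.castSucc) (g k.castSucc)) *
        ∏ l ∈ Finset.univ.erase k.castSucc, d l| ≤ T * (P * r) := by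
      intro k _
      rw [abs_mul, hfc, hgc]
      exact mul_le_mul (hT _) (hoth k) (abs_nonneg _) hT0
    refine (Finset.sum_le_card_nsmul _ _ _ this).trans ?_
    simp only [Finset.card_univ, Fintype.card_fin, nsmul_eq_mul]
    have : (b : ℝ) ≤ n := by exact_mod_cast hb.le
    gcongr
  have hfin : |auxL x t (Q i j)| * P ≤ E + n * (T * (P * r)) := by
    rw [← hlast, ← abs_mul]
    have : auxL x t (Q i j) * ∏ l ∈ Finset.univ.erase (Fin.last b), d l =
      auxL x t (Q.submatrix f g).det - S := by rw [hdet]; ring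
    rw [this, hlast]
    exact (abs_sub _ _).trans (add_le_add hEE hSb)
  have : E / P + n * (T * r) = (E + n * (T * (P * r))) / P := by
    field_simp
  rw [this, le_div_iff₀ hP]
  exact hfin

theorem aux_mulVec_le {n : ℕ} (O : Matrix (Fin n) (Fin n) ℝ) (hO : ∀ i j, |O i j| ≤ 1)
    (y : Fin n → ℝ) (i : Fin n) : |(Oᵀ *ᵥ y) i| ≤ n * ‖y‖ := by
  simp only [Matrix.mulVec, dotProduct, Matrix.transpose_apply]
  refine (Finset.abs_sum_le_sum_abs _ _).trans ?_
  have : ∀ k ∈ (Finset.univ : Finset (Fin n)), |O k i * y k| ≤ ‖y‖ := by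
    intro k _
    rw [abs_mul]
    exact (mul_le_of_le_one_left (abs_nonneg _) (hO _ _)).trans (norm_le_pi_norm y k)
  refine (Finset.sum_le_card_nsmul _ _ _ this).trans ?_
  simp

theorem aux_bil_le {n : ℕ} (N : Matrix (Fin n) (Fin n) ℝ) (u v : Fin n → ℝ) (B U V : ℝ)
    (hU : ∀ i, |u i| ≤ U) (hV : ∀ i, |v i| ≤ V) (hB : 0 ≤ B)
    (h : ∀ i j, u i ≠ 0 → v j ≠ 0 → |N i j| ≤ B) :
    |u ⬝ᵥ N *ᵥ v| ≤ n * (n * (U * (B * V))) := by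
  simp only [Matrix.mulVec, dotProduct]
  refine (Finset.abs_sum_le_sum_abs _ _).trans ?_
  have h1 : ∀ i ∈ (Finset.univ : Finset (Fin n)), |u i * ∑ j, N i j * v j| ≤
      n * (U * (B * V)) := by
    intro i _
    rw [Finset.mul_sum]
    refine (Finset.abs_sum_le_sum_abs _ _).trans ?_
    have h2 : ∀ j ∈ (Finset.univ : Finset (Fin n)), |u i * (N i j * v j)| ≤ U * (B * V) := by
      intro j _
      have hU0 := (abs_nonneg _).trans (hU i)
      have hV0 := (abs_nonneg _).trans (hV i)
      by_cases h3 : u i = 0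
      · rw [h3]; simp; positivity
      by_cases h4 : v j = 0
      · rw [h4]; simp; positivity
      rw [abs_mul, abs_mul]
      exact mul_le_mul (hU i) (mul_le_mul (h i j h3 h4) (hV j) (abs_nonneg _) hB) (by positivity)
        hU0
    refine (Finset.sum_le_card_nsmul _ _ _ h2).trans ?_
    simp
  refine (Finset.sum_le_card_nsmul _ _ _ h1).trans ?_
  simp

theorem aux_subspace {n b : ℕ} (hb : b ≤ n) (O : Matrix (Fin n) (Fin n) ℝ) (h1 : Oᵀ * O = 1) :
    ∃ Y : Submodule ℝ (Fin n → ℝ), Module.finrank ℝ Y = n - b ∧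
      ∀ y ∈ Y, ∀ i : Fin n, i.1 < b → (Oᵀ *ᵥ y) i = 0 := by
  let v : Fin (n - b) → Fin n := fun k => ⟨b + k.1, by omega⟩
  have hv : Function.Injective v := by
    intro a c h
    have := congrArg Fin.val h
    simp [v] at this
    exact Fin.ext this
  have hli : LinearIndependent ℝ (fun k => O.col (v k)) := by
    have : LinearIndependent ℝ O.col :=
      Matrix.linearIndependent_cols_of_isUnit (IsUnit.of_mul_eq_one_right _ h1)
    exact this.comp v hv
  refine ⟨Submodule.span ℝ (Set.range fun k => O.col (v k)), ?_, ?_⟩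
  · rw [finrank_span_eq_card hli]; simp
  · intro y hy i hi
    induction hy using Submodule.span_induction with
    | mem y hy =>
      obtain ⟨k, rfl⟩ := hy
      have : (Oᵀ *ᵥ O.col (v k)) i = (Oᵀ * O) i (v k) := rfl
      have hne : i ≠ v k := by
        intro h
        have := congrArg Fin.val h
        simp [v] at this
        omega
      simp only [this, h1, Matrix.one_apply_ne hne]
    | zero => simp
    | add y z _ _ hy hz => rw [Matrix.mulVec_add, Pi.add_apply, hy, hz, add_zero]
    | smul r y _ hy => rw [Matrix.mulVec_smul, Pi.smul_apply, hy, smul_zero]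

/-- Lemma 5.1 of the paper: if `Δ^{(c,b)}(x⁰) ≠ 0` then there
is an `(n−b)`-dimensional subspace `Y` on which the trilinear form
`Yᵀ H_c(t) Y'` is controlled.  Here `lam0` lists the eigenvalues of `H_c(x⁰)`
with multiplicity in order of decreasing absolute value, so `lam0 ⟨b-1,_⟩` and
`lam0 ⟨b,_⟩` are the paper's `λ_b^{(c)}(x⁰)` and `λ_{b+1}^{(c)}(x⁰)`. -/
theorem statement8 (n : ℕ) :
    ∃ A : ℝ, 0 < A ∧
      ∀ (c : MvPolynomial (Fin n) ℝ), c ≠ 0 → c.IsHomogeneous 3 →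
      ∀ (b : ℕ) (hb1 : 1 ≤ b) (hb2 : b ≤ n - 1),
      ∀ (x0 : Fin n → ℝ) (lam0 : Fin n → ℝ),
        (hessMat c x0).charpoly = ∏ i, (Polynomial.X - Polynomial.C (lam0 i)) →
        (∀ i j : Fin n, i ≤ j → |lam0 j| ≤ |lam0 i|) →
        minorsVec c b x0 ≠ 0 →
        ∃ Y : Submodule ℝ (Fin n → ℝ), Module.finrank ℝ Y = n - b ∧
          ∀ y ∈ Y, ∀ y' ∈ Y, ∀ t : Fin n → ℝ,
            |y ⬝ᵥ (hessMat c t).mulVec y'| ≤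
              A * (supMIdx (jacMulVec c (b + 1) x0 t) / supMIdx (minorsVec c b x0)
                  + |lam0 ⟨b, by omega⟩| * ‖t‖ / |lam0 ⟨b - 1, by omega⟩|) *
                ‖y‖ * ‖y'‖ := by
  refine ⟨(n ^ 4 : ℝ) * ((n ^ n * n ^ n) * (n ^ n * n.factorial) + n * (n * (n * (6 * n)))) + 1,
    by positivity, ?_⟩
  intro c _ hc b hb1 hb2 x0 lam hchar hl hDelta
  have hbn : b < n := by omega
  have hn : 1 ≤ n := by omega
  obtain ⟨O, hO1, hO2, hO3⟩ := aux_spec (hessMat c x0) (aux_hess_symm c x0) lam hchar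
  have hO := aux_orth_le O hO1
  have hM : hessMat c x0 = O * Matrix.diagonal lam * Oᵀ := by
    rw [← hO3]
    calc hessMat c x0 = (O * Oᵀ) * hessMat c x0 * (O * Oᵀ) := by rw [hO2]; simp
      _ = _ := by simp only [Matrix.mul_assoc]
  obtain ⟨Y, hY1, hY2⟩ := aux_subspace hbn.le O hO1
  refine ⟨Y, hY1, ?_⟩
  intro y hy y' hy' t
  set P := ∏ i : Fin b, |lam (Fin.castLE hbn.le i)| with hPdef
  set D := supMIdx (minorsVec c b x0) with hD
  set E := supMIdx (jacMulVec c (b + 1) x0 t) with hE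
  have hE0 : 0 ≤ E := aux_sup_nonneg _
  have hD0 : 0 < D := by
    obtain ⟨p, hp⟩ := Function.ne_iff.mp hDelta
    exact (abs_pos.mpr hp).trans_le (aux_le_sup _ p)
  have hDP : D ≤ (n ^ n * n.factorial : ℝ) * P := by
    obtain ⟨p0, _⟩ := Function.ne_iff.mp hDelta
    have : Nonempty (MIdx n b) := ⟨p0⟩
    refine ciSup_le fun p => ?_
    have h1 : minorsVec c b x0 p = ((hessMat c x0).submatrix p.1.1 p.1.2).det := by
      rw [minorsVec, minorPoly, RingHom.map_det]
      rfl
    rw [h1]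
    exact aux_Delta_bound hn hbn.le _ O lam hl hO hM _ _
  have hP0 : 0 < P := by
    have h1 : 0 < (n ^ n * n.factorial : ℝ) * P := hD0.trans_le hDP
    exact pos_of_mul_pos_right h1 (by positivity)
  obtain ⟨CO, hCO⟩ : ∃ CO : Matrix (Fin n) (Fin n) (MvPolynomial (Fin n) ℝ),
      ∀ i j, CO i j = C (O i j) := ⟨fun i j => C (O i j), fun _ _ => rfl⟩
  let Q := COᵀ * hessPoly c * CO
  have hQe : ∀ i j, eval x0 (Q i j) = Matrix.diagonal lam i j := by
    intro i j
    rw [← hO3]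
    simp [Q, hCO, Matrix.mul_apply, hessMat]
  have hQL : ∀ i j, auxL x0 t (Q i j) = (Oᵀ * hessMat c t * O) i j := by
    intro i j
    simp only [Q, Matrix.mul_apply, Matrix.transpose_apply, map_sum, Finset.sum_mul, hCO]
    refine Finset.sum_congr rfl fun k _ => Finset.sum_congr rfl fun l _ => ?_
    have : C (O l i) * hessPoly c l k * C (O k j) = (O l i * O k j) • hessPoly c l k := by
      rw [smul_eq_C_mul, C_mul]; ring
    rw [this, map_smul, auxL_hess c hc, smul_eq_mul]
    ring
  have hT : ∀ i, |auxL x0 t (Q i i)| ≤ n * (n * (1 * ((6 * n * ‖t‖) * 1))) := by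
    intro i
    have h1 : (Oᵀ * hessMat c t * O) i i =
        (fun k => O k i) ⬝ᵥ (hessMat c t) *ᵥ (fun k => O k i) := by
      rw [Matrix.mul_assoc, Matrix.mul_apply]
      rfl
    rw [hQL, h1]
    exact aux_bil_le _ _ _ _ _ _ (fun k => hO k i) (fun k => hO k i) (by positivity)
      (fun k l _ _ => aux_hess_bound c hc t k l)
  have hkey := aux_key hbn hb1 x0 t Q lam hQe hl hP0 _ _ hT
    (fun f g => aux_jac_bound hn hbn c x0 t O CO hCO hO f g)
  rw [← hE, ← hPdef] at hkey
  have hyy : y ⬝ᵥ (hessMat c t) *ᵥ y' =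
      (Oᵀ *ᵥ y) ⬝ᵥ (Oᵀ * hessMat c t * O) *ᵥ (Oᵀ *ᵥ y') := by
    have h1 : (Oᵀ * hessMat c t * O) *ᵥ (Oᵀ *ᵥ y') = Oᵀ *ᵥ (hessMat c t *ᵥ y') := by
      rw [Matrix.mulVec_mulVec, Matrix.mulVec_mulVec, Matrix.mul_assoc, hO2, Matrix.mul_one]
    rw [h1, Matrix.dotProduct_mulVec (Oᵀ *ᵥ y), Matrix.vecMul_transpose, Matrix.mulVec_mulVec, hO2,
      Matrix.one_mulVec]
  have hnz : ∀ y ∈ Y, ∀ i, (Oᵀ *ᵥ y) i ≠ 0 → b ≤ i.1 := by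
    intro y hy i h
    by_contra hlt
    exact h (hY2 y hy i (by omega))
  set q := |lam ⟨b, hbn⟩| / |lam ⟨b - 1, by omega⟩| with hq
  have hq0 : 0 ≤ q := by positivity
  have hfin := aux_bil_le (Oᵀ * hessMat c t * O) (Oᵀ *ᵥ y) (Oᵀ *ᵥ y') (U := n * ‖y‖) (V := n * ‖y'‖)
    (hU := aux_mulVec_le O hO y) (hV := aux_mulVec_le O hO y')
    (B := (n ^ n * n ^ n : ℝ) * E / P + n * (n * (n * (1 * ((6 * n * ‖t‖) * 1))) * q))
    (hB := by positivity)
    (h := fun i j hi hj => by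
      rw [← hQL]; exact hkey i j (hnz y hy i hi) (hnz y' hy' j hj))
  rw [hyy]
  refine hfin.trans ?_
  have hEP : E / P ≤ (n ^ n * n.factorial : ℝ) * (E / D) := by
    rw [← mul_div_assoc, div_le_div_iff₀ hP0 hD0]
    nlinarith [mul_le_mul_of_nonneg_left hDP hE0]
  have hqt : |lam ⟨b, hbn⟩| * ‖t‖ / |lam ⟨b - 1, by omega⟩| = q * ‖t‖ := by
    rw [hq]; ring
  rw [hqt]
  have hED : 0 ≤ E / D := by positivity
  set e := E / D with he
  set C1 := (n ^ n * n.factorial : ℝ) with hC1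
  set C2 := (n ^ n * n ^ n : ℝ) with hC2
  have hC10 : 0 ≤ C1 := by positivity
  have hC20 : 0 ≤ C2 := by positivity
  have hqt0 : 0 ≤ q * ‖t‖ := by positivity
  set C3 := (n * (n * (n * (6 * n))) : ℝ) with hC3
  have hC30 : 0 ≤ C3 := by positivity
  have hB : C2 * E / P + n * (n * (n * (1 * ((6 * n * ‖t‖) * 1))) * q) ≤
      (C2 * C1 + C3) * (e + q * ‖t‖) := by
    have a1 : C2 * E / P ≤ C2 * C1 * e := by
      rw [mul_div_assoc, mul_assoc C2]; exact mul_le_mul_of_nonneg_left hEP hC20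
    have a2 : n * (n * (n * (1 * ((6 * n * ‖t‖) * 1))) * q) = C3 * (q * ‖t‖) := by
      rw [hC3]; ring
    rw [a2]
    have a3 : 0 ≤ C2 * C1 * (q * ‖t‖) := by positivity
    have a4 : 0 ≤ C3 * e := by positivity
    nlinarith
  calc (n : ℝ) * (n * (n * ‖y‖ * ((C2 * E / P + n * (n * (n * (1 * ((6 * n * ‖t‖) * 1))) * q))
        * (n * ‖y'‖))))
      ≤ (n : ℝ) * (n * (n * ‖y‖ * (((C2 * C1 + C3) * (e + q * ‖t‖)) * (n * ‖y'‖)))) := by gcongr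
    _ = (n ^ 4 * (C2 * C1 + C3)) * (e + q * ‖t‖) * ‖y‖ * ‖y'‖ := by ring
    _ ≤ _ := by
      gcongr
      linarith
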